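/- Let σ ≥ τ ≥ 0 be integers, F₁, F₂ relatively prime homogeneous forms in R = k[x,y] with deg F₁ = n + σ and deg F₂ = n + τ, let I = (x,y)^τ F₁ + (x,y)^σ F₂, and write d = n + σ + τ. Then for every integer s ≥ 1, the Castelnuovo–Mumford regularity of I^s is reg I^s = max{ sd, sd − (s−1)τ + n − 1 }. -/

import Mathlib

open MvPolynomial

/-- An element `v` of the graded free module `⊕ᵢ R(−t₀ i)` over `R = k[x,y]` is
homogeneous of degree `e`; i.e. each component `v i` is homogeneous of degree `e - t₀ i`. -/
def VecIsHomogeneous {k : Type*} [Field k] {p : ℕ} (t0 : Fin p → ℕ) (e : ℕ)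
    (v : Fin p → MvPolynomial (Fin 2) k) : Prop :=
  ∀ i, (v i).IsHomogeneous (e - t0 i) ∧ (v i ≠ 0 → t0 i ≤ e)

/-- `HasMinimalGradedResolution I t0 t1` says that the (necessarily unique up to
isomorphism) minimal homogeneous free resolution of the ideal `I ⊆ k[x,y]` has the form
`0 → ⊕ⱼ R(−t1 j) → ⊕ⱼ R(−t0 j) → I → 0` :
there are homogeneous generators `g j` of `I` of degrees `t0 j`, no one of which is
redundant, and a homogeneous basis `s j` (of degrees `t1 j`) of the syzygy module of `g`,
with all entries of the syzygy matrix in the maximal homogeneous ideal. -/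
def HasMinimalGradedResolution {k : Type*} [Field k] {p q : ℕ}
    (I : Ideal (MvPolynomial (Fin 2) k)) (t0 : Fin p → ℕ) (t1 : Fin q → ℕ) : Prop :=
  ∃ (g : Fin p → MvPolynomial (Fin 2) k) (s : Fin q → Fin p → MvPolynomial (Fin 2) k),
    (∀ j, (g j).IsHomogeneous (t0 j)) ∧
    Ideal.span (Set.range g) = I ∧
    (∀ j, g j ∉ Ideal.span (g '' {j' | j' ≠ j})) ∧
    (∀ j, VecIsHomogeneous t0 (t1 j) (s j)) ∧
    (∀ j i, MvPolynomial.coeff 0 (s j i) = 0) ∧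
    LinearIndependent (MvPolynomial (Fin 2) k) s ∧
    (∀ v : Fin p → MvPolynomial (Fin 2) k,
      (∑ i, v i * g i = 0) ↔ v ∈ Submodule.span (MvPolynomial (Fin 2) k) (Set.range s))

/-- The Castelnuovo-Mumford regularity `max_{i,j} (t_{i,j} - i)` read off from the twists
of a free resolution `0 → ⊕ⱼ R(−t1 j) → ⊕ⱼ R(−t0 j) → I → 0`. -/
noncomputable def regOfTwists {p q : ℕ} (t0 : Fin p → ℕ) (t1 : Fin q → ℕ) : ℤ :=
  max ((Finset.univ.sup t0 : ℕ) : ℤ) (((Finset.univ.sup t1 : ℕ) : ℤ) - 1)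

/-- `I ⊆ k[x,y]` has Castelnuovo-Mumford regularity `r` (for ideals of projective
dimension at most one). -/
def HasRegularity {k : Type*} [Field k] (I : Ideal (MvPolynomial (Fin 2) k)) (r : ℤ) : Prop :=
  ∃ (p q : ℕ) (t0 : Fin p → ℕ) (t1 : Fin q → ℕ),
    HasMinimalGradedResolution I t0 t1 ∧ regOfTwists t0 t1 = r

namespace TruncationPowers

variable {k : Type*} [Field k]

section Components

attribute [local instance] MvPolynomial.gradedAlgebra

lemma coe_decompose_eq_homogeneousComponent (f : MvPolynomial (Fin 2) k) (i : ℕ) :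
    (DirectSum.decompose (homogeneousSubmodule (Fin 2) k) f i : MvPolynomial (Fin 2) k) =
      homogeneousComponent i f :=
  decomposition.decompose'_apply f i

lemma homogeneousComponent_add_mul {g : MvPolynomial (Fin 2) k} {D : ℕ}
    (hg : g.IsHomogeneous D) (a : MvPolynomial (Fin 2) k) (j : ℕ) :
    homogeneousComponent (j + D) (a * g) = homogeneousComponent j a * g := by
  simp_rw [← coe_decompose_eq_homogeneousComponent]
  exact DirectSum.coe_decompose_mul_add_of_right_mem _ hg

lemma homogeneousComponent_mul_of_lt {g : MvPolynomial (Fin 2) k} {D i : ℕ}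
    (hg : g.IsHomogeneous D) (a : MvPolynomial (Fin 2) k) (h : i < D) :
    homogeneousComponent i (a * g) = 0 := by
  rw [← coe_decompose_eq_homogeneousComponent]
  exact DirectSum.coe_decompose_mul_of_right_mem_of_not_le _ hg (by omega)

end Components

lemma exists_eq_C_mul_add_X_mul {f : MvPolynomial (Fin 2) k} {e : ℕ}
    (hf : f.IsHomogeneous (e + 1)) :
    ∃ (c : k) (f' : MvPolynomial (Fin 2) k), f'.IsHomogeneous e ∧
      f = C c * X 1 ^ (e + 1) + X 0 * f' := by
  refine ⟨coeff (Finsupp.single 1 (e + 1)) f, f.divMonomial (Finsupp.single 0 1), ?_, ?_⟩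
  · intro m hm
    rw [coeff_divMonomial] at hm
    have := hf hm
    simp only [map_add, Finsupp.weight_single] at this
    simp at this
    omega
  · conv_lhs => rw [← divMonomial_add_modMonomial_single f 0]
    rw [add_comm]
    congr 1
    ext m
    rw [C_mul_X_pow_eq_monomial, coeff_monomial]
    by_cases h : Finsupp.single 0 1 ≤ m
    · rw [coeff_modMonomial_of_le _ h, if_neg]
      rintro rfl
      have := h 0
      simp at this
    · rw [coeff_modMonomial_of_not_le _ h]
      have h0 : m 0 = 0 := by
        by_contra h0
        exact h (by rw [Finsupp.single_le_iff]; omega)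
      split_ifs with h1
      · rw [h1]
      · refine hf.coeff_eq_zero fun h2 => h1 ?_
        rw [Finsupp.degree_eq_sum, Fin.sum_univ_two, h0, zero_add] at h2
        ext i
        fin_cases i
        · simp [h0]
        · simp [h2]

lemma exists_eq_C {f : MvPolynomial (Fin 2) k} (hf : f.IsHomogeneous 0) : ∃ c : k, f = C c :=
  ⟨_, (totalDegree_eq_zero_iff_eq_C).1 ((totalDegree_zero_iff_isHomogeneous _).2 hf)⟩

lemma finrank_homogeneousSubmodule (e : ℕ) :
    Module.finrank k (homogeneousSubmodule (Fin 2) k e) = e + 1 := by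
  rw [homogeneousSubmodule_eq_finsupp_supported]
  rw [LinearEquiv.finrank_eq (AddMonoidAlgebra.supportedEquivFinsupp _)]
  let φ : {d : Fin 2 →₀ ℕ | d.degree = e} ≃ Fin (e + 1) :=
    { toFun := fun d => ⟨d.1 0, by
        have := d.2
        simp only [Set.mem_ofPred_eq, Finsupp.degree_eq_sum, Fin.sum_univ_two] at this
        omega⟩
      invFun := fun i => ⟨Finsupp.single 0 i.1 + Finsupp.single 1 (e - i.1), by
        simp only [Set.mem_ofPred_eq, map_add, Finsupp.degree_single]
        omega⟩
      left_inv := by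
        rintro ⟨d, hd⟩
        simp only [Set.mem_ofPred_eq, Finsupp.degree_eq_sum, Fin.sum_univ_two] at hd
        ext i
        fin_cases i
        · simp
        · simp
          omega
      right_inv := by
        rintro ⟨i, hi⟩
        simp }
  rw [LinearEquiv.finrank_eq (Finsupp.domLCongr φ)]
  simp

instance finite_homogeneousSubmodule (e : ℕ) :
    Module.Finite k (homogeneousSubmodule (Fin 2) k e) :=
  Module.finite_of_finrank_pos (by rw [finrank_homogeneousSubmodule]; omega)

lemma eq_zero_of_mem_span_of_lt {A : Set (MvPolynomial (Fin 2) k)} {D i : ℕ}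
    (hA : ∀ a ∈ A, a.IsHomogeneous D) {f : MvPolynomial (Fin 2) k} (hf : f ∈ Ideal.span A)
    (hfi : f.IsHomogeneous i) (hi : i < D) : f = 0 := by
  have key : ∀ g ∈ Ideal.span A, homogeneousComponent i g = 0 := by
    intro g hg
    induction hg using Submodule.closure_induction with
    | zero => simp
    | add x y _ _ hx hy => rw [map_add, hx, hy, add_zero]
    | smul_mem a x hx => exact homogeneousComponent_mul_of_lt (hA x hx) a hi
  rw [← homogeneousComponent_eq_self hfi, key f hf]

lemma mem_span_X_pow_of_isHomogeneous {f : MvPolynomial (Fin 2) k} {j : ℕ}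
    (hf : f.IsHomogeneous j) :
    f ∈ (Ideal.span {X 0, X 1} : Ideal (MvPolynomial (Fin 2) k)) ^ j := by
  induction j generalizing f with
  | zero => simp
  | succ j ih =>
    obtain ⟨c, f', hf', rfl⟩ := exists_eq_C_mul_add_X_mul hf
    refine add_mem (Ideal.mul_mem_left _ _ (Ideal.pow_mem_pow (Ideal.subset_span (by simp)) _)) ?_
    rw [pow_succ']
    exact Ideal.mul_mem_mul (Ideal.subset_span (by simp)) (ih hf')

lemma mem_pow_mul_of_mem_span {A : Set (MvPolynomial (Fin 2) k)} {D j : ℕ}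
    (hA : ∀ a ∈ A, a.IsHomogeneous D) {f : MvPolynomial (Fin 2) k} (hf : f ∈ Ideal.span A)
    (hfj : f.IsHomogeneous (j + D)) :
    f ∈ (Ideal.span {X 0, X 1}) ^ j * Ideal.span A := by
  have key : ∀ g ∈ Ideal.span A,
      homogeneousComponent (j + D) g ∈ (Ideal.span {X 0, X 1}) ^ j * Ideal.span A := by
    intro g hg
    induction hg using Submodule.closure_induction with
    | zero => simp
    | add x y _ _ hx hy => rw [map_add]; exact add_mem hx hy
    | smul_mem a x hx =>
      rw [smul_eq_mul, homogeneousComponent_add_mul (hA x hx)]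
      exact Ideal.mul_mem_mul
        (mem_span_X_pow_of_isHomogeneous (homogeneousComponent_isHomogeneous _ _))
        (Ideal.subset_span hx)
  rw [← homogeneousComponent_eq_self hfj]
  exact key f hf

lemma exists_coeffs_of_mem_span {ι : Type*} [Fintype ι] {g : ι → MvPolynomial (Fin 2) k} {D j : ℕ}
    (hg : ∀ i, (g i).IsHomogeneous D) {f : MvPolynomial (Fin 2) k}
    (hf : f ∈ Ideal.span (Set.range g)) (hfj : f.IsHomogeneous (j + D)) :
    ∃ w : ι → MvPolynomial (Fin 2) k, (∀ i, (w i).IsHomogeneous j) ∧ ∑ i, w i * g i = f := by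
  obtain ⟨c, rfl⟩ := Ideal.mem_span_range_iff_exists_fun.1 hf
  refine ⟨fun i => homogeneousComponent j (c i),
    fun i => homogeneousComponent_isHomogeneous _ _, ?_⟩
  rw [← homogeneousComponent_eq_self hfj, map_sum]
  exact Finset.sum_congr rfl fun i _ => (homogeneousComponent_add_mul (hg i) _ _).symm

lemma exists_adapted_family {V : Type*} [AddCommGroup V] [Module k V] (W : ℕ → Submodule k V)
    (hW : Monotone W) (h0 : W 0 = ⊥) (hfin : ∀ N, Module.Finite k (W N)) (N : ℕ) :
    ∃ (q : ℕ) (h : Fin q → V) (e : Fin q → ℕ),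
      Submodule.span k (Set.range h) = W N ∧ (∀ j, 1 ≤ e j ∧ e j ≤ N ∧ h j ∈ W (e j)) ∧
      ∀ i ≤ N, ∀ c : Fin q → k, ∑ j, c j • h j ∈ W i → ∀ j, i < e j → c j = 0 := by
  induction N with
  | zero =>
    refine ⟨0, Fin.elim0, Fin.elim0, ?_, fun j => j.elim0, fun _ _ _ _ j => j.elim0⟩
    simp [h0]
  | succ N ih =>
    obtain ⟨q, h, e, hspan, he, hc⟩ := ih
    obtain ⟨C₀, hC₀⟩ := Submodule.exists_isCompl (W N)
    have hle : W N ≤ W (N + 1) := hW (Nat.le_succ N)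
    set C := C₀ ⊓ W (N + 1) with hC
    have hdisj : Disjoint (W N) C := hC₀.disjoint.mono_right inf_le_left
    have hsup : W N ⊔ C = W (N + 1) := by
      rw [hC, ← sup_inf_assoc_of_le _ hle, hC₀.sup_eq_top, top_inf_eq]
    have : Module.Finite k C := Submodule.finiteDimensional_of_le (inf_le_right : C ≤ W (N + 1))
    set b := Module.finBasis k C
    have hbspan : Submodule.span k (Set.range fun i => (b i : V)) = C := by
      have := congrArg (Submodule.map C.subtype) b.span_eq
      rw [Submodule.map_span, Submodule.map_top, Submodule.range_subtype, ← Set.range_comp] at this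
      exact this
    have hold : ∀ c : Fin q → k, ∑ j, c j • h j ∈ W N := fun c =>
      hspan ▸ Submodule.sum_mem _ fun j _ =>
        Submodule.smul_mem _ _ (Submodule.subset_span ⟨j, rfl⟩)
    refine ⟨q + Module.finrank k C, Fin.append h fun i => (b i : V),
      Fin.append e fun _ => N + 1, ?_, ?_, ?_⟩
    · have : Set.range (Fin.append h fun i => (b i : V)) =
          Set.range h ∪ Set.range fun i => (b i : V) := by
        ext x
        constructor
        · rintro ⟨i, rfl⟩
          refine Fin.addCases (fun i => ?_) (fun i => ?_) i <;> simp
        · rintro (⟨i, rfl⟩ | ⟨i, rfl⟩)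
          · exact ⟨Fin.castAdd _ i, by simp⟩
          · exact ⟨Fin.natAdd _ i, by simp⟩
      rw [this, Submodule.span_union, hspan, hbspan, hsup]
    · intro j
      refine Fin.addCases (fun i => ?_) (fun i => ?_) j
      · simp only [Fin.append_left]
        exact ⟨(he i).1, (he i).2.1.trans (Nat.le_succ N), (he i).2.2⟩
      · simp only [Fin.append_right]
        exact ⟨by omega, le_rfl, (b i).2.2⟩
    · intro i hi c hmem
      rw [Fin.sum_univ_add] at hmem
      simp only [Fin.append_left, Fin.append_right] at hmem
      rcases Nat.lt_or_ge N i with hNi | hiN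
      · intro j hj
        exfalso
        revert hj
        refine Fin.addCases (fun l => ?_) (fun l => ?_) j
        · simp only [Fin.append_left]
          have := (he l).2.1
          omega
        · simp only [Fin.append_right]
          omega
      · have hnew : ∑ l, c (Fin.natAdd q l) • (b l : V) = 0 := by
          refine (Submodule.disjoint_def.1 hdisj) _ ?_ ?_
          · exact (Submodule.add_mem_iff_right _ (hold _)).1 (hW hiN hmem)
          · exact Submodule.sum_mem _ fun l _ => Submodule.smul_mem _ _ (b l).2
        rw [hnew, add_zero] at hmem
        intro j
        refine Fin.addCases (fun l => ?_) (fun l => ?_) j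
        · simp only [Fin.append_left]
          exact hc i hiN _ hmem l
        · intro _
          refine (Fintype.linearIndependent_iff.1 b.linearIndependent)
            (fun l => c (Fin.natAdd q l)) ?_ l
          apply Subtype.ext
          simpa using hnew

section Resolution

variable {D q : ℕ} {h : Fin q → MvPolynomial (Fin 2) k} {e : Fin q → ℕ}
  {g₀ : MvPolynomial (Fin 2) k} {w : Fin q → Fin (q + 1) → MvPolynomial (Fin 2) k}

/-- The generators `g₀, x h₁, …, x h_q`. -/
noncomputable def consGens (g₀ : MvPolynomial (Fin 2) k) (h : Fin q → MvPolynomial (Fin 2) k) :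
    Fin (q + 1) → MvPolynomial (Fin 2) k :=
  Fin.cons g₀ fun j => X 0 * h j

/-- The syzygies `y ^ eⱼ εⱼ - x wⱼ` of the generators `consGens`. -/
noncomputable def consSyz (e : Fin q → ℕ) (w : Fin q → Fin (q + 1) → MvPolynomial (Fin 2) k)
    (j : Fin q) : Fin (q + 1) → MvPolynomial (Fin 2) k :=
  Pi.single j.succ (X 1 ^ e j) - (X 0 : MvPolynomial (Fin 2) k) • w j

lemma isHomogeneous_consGens (hg₀ : g₀.IsHomogeneous (D + 1)) (hh : ∀ j, (h j).IsHomogeneous D)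
    (i : Fin (q + 1)) : (consGens g₀ h i).IsHomogeneous (D + 1) := by
  refine Fin.cases hg₀ (fun j => ?_) i
  rw [add_comm]
  exact (isHomogeneous_X _ _).mul (hh j)

lemma isHomogeneous_consSyz (he : ∀ j, 1 ≤ e j) (hw : ∀ j i, (w j i).IsHomogeneous (e j - 1))
    (j : Fin q) (i : Fin (q + 1)) : (consSyz e w j i).IsHomogeneous (e j) := by
  refine IsHomogeneous.sub ?_ ?_
  · rcases eq_or_ne i j.succ with rfl | hne
    · rw [Pi.single_eq_same]
      exact isHomogeneous_X_pow _ _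
    · rw [Pi.single_eq_of_ne hne]
      exact isHomogeneous_zero _ _ _
  · have := (isHomogeneous_X k (0 : Fin 2)).mul (hw j i)
    rwa [Nat.add_sub_cancel' (he j)] at this

lemma sum_consSyz_mul_consGens
    (hw : ∀ j, ∑ i, w j i * consGens g₀ h i = X 1 ^ e j * h j) (j : Fin q) :
    ∑ i, consSyz e w j i * consGens g₀ h i = 0 := by
  have : ∑ i, consSyz e w j i * consGens g₀ h i =
      X 1 ^ e j * (X 0 * h j) - X 0 * ∑ i, w j i * consGens g₀ h i := by
    simp only [consSyz, Pi.sub_apply, sub_mul, Finset.sum_sub_distrib, Pi.smul_apply, smul_eq_mul,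
      Finset.mul_sum, mul_assoc]
    congr 1
    rw [Finset.sum_eq_single j.succ]
    · simp [consGens]
    · intro b _ hb
      simp [Pi.single_eq_of_ne hb]
    · simp
  rw [this, hw]
  ring

lemma linearIndependent_consSyz :
    LinearIndependent (MvPolynomial (Fin 2) k) (consSyz e w) := by
  apply LinearIndependent.of_comp (LinearMap.funLeft _ _ Fin.succ)
  refine Matrix.linearIndependent_rows_of_det_ne_zero
    (A := Matrix.of fun j i => consSyz e w j (Fin.succ i)) fun hdet => ?_
  have := congrArg (eval ![(0 : k), 1]) hdet
  rw [RingHom.map_det, map_zero] at this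
  have hone : (eval ![(0 : k), 1]).mapMatrix (Matrix.of fun j i => consSyz e w j (Fin.succ i)) =
      1 := by
    ext j i
    rcases eq_or_ne i j with rfl | hne
    · simp [consSyz]
    · simp [consSyz, hne, Matrix.one_apply_ne hne.symm]
  rw [hone, Matrix.det_one] at this
  exact one_ne_zero this

lemma leading_coeffs_of_sum_eq_X_mul (hg₀e : eval ![0, 1] g₀ ≠ 0) {E : ℕ}
    {v v' : Fin (q + 1) → MvPolynomial (Fin 2) k} {c : Fin (q + 1) → k}
    (hv : ∀ i, v i = C (c i) * X 1 ^ E + X 0 * v' i)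
    {f : MvPolynomial (Fin 2) k} (hvf : ∑ i, v i * consGens g₀ h i = X 0 * f) :
    c 0 = 0 ∧
      X 1 ^ E * ∑ j, C (c (Fin.succ j)) * h j = f - ∑ i, v' i * consGens g₀ h i := by
  have hc : c 0 = 0 := by
    have := congrArg (eval ![(0 : k), 1]) hvf
    rw [Fin.sum_univ_succ] at this
    simp [consGens, hv, hg₀e] at this
    exact this
  refine ⟨hc, ?_⟩
  have hX : (X 0 : MvPolynomial (Fin 2) k) ≠ 0 := X_ne_zero 0
  apply mul_left_cancel₀ hX
  rw [Fin.sum_univ_succ] at hvf ⊢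
  simp only [consGens, Fin.cons_zero, Fin.cons_succ, hv, hc, map_zero, zero_mul, zero_add,
    add_mul, Finset.sum_add_distrib] at hvf ⊢
  have h₁ : ∑ j, C (c (Fin.succ j)) * X 1 ^ E * (X 0 * h j) =
      X 0 * (X 1 ^ E * ∑ j, C (c (Fin.succ j)) * h j) := by
    simp only [Finset.mul_sum]
    exact Finset.sum_congr rfl fun _ _ => by ring
  have h₂ : ∑ j, X 0 * v' (Fin.succ j) * (X 0 * h j) =
      X 0 * ∑ j, v' (Fin.succ j) * (X 0 * h j) := by
    simp only [Finset.mul_sum, mul_assoc]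
  rw [h₁, h₂] at hvf
  linear_combination hvf

lemma mem_span_consSyz_of_isHomogeneous (he : ∀ j, 1 ≤ e j) (hg₀e : eval ![0, 1] g₀ ≠ 0)
    (hadapt : ∀ i, ∀ c : Fin q → k,
      X 1 ^ i * ∑ j, C (c j) * h j ∈ Ideal.span (Set.range (consGens g₀ h)) →
        ∀ j, i < e j → c j = 0)
    (hwh : ∀ j i, (w j i).IsHomogeneous (e j - 1))
    (hw : ∀ j, ∑ i, w j i * consGens g₀ h i = X 1 ^ e j * h j)
    {E : ℕ} {v : Fin (q + 1) → MvPolynomial (Fin 2) k} (hv : ∀ i, (v i).IsHomogeneous E)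
    (hv0 : ∑ i, v i * consGens g₀ h i = 0) :
    v ∈ Submodule.span (MvPolynomial (Fin 2) k) (Set.range (consSyz e w)) := by
  induction E generalizing v with
  | zero =>
    choose c hc using fun i => exists_eq_C (hv i)
    obtain ⟨hc0, hsum⟩ := leading_coeffs_of_sum_eq_X_mul hg₀e
      (E := 0) (v := v) (v' := fun _ => 0) (c := c)
      (fun i => by simp [hc]) (f := 0) (by simpa using hv0)
    have hcs := hadapt 0 (fun j => c j.succ) (by rw [hsum]; simp)
    have : v = 0 := by
      ext1 i
      refine Fin.cases ?_ (fun j => ?_) i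
      · simp [hc, hc0]
      · simp [hc, hcs j (he j)]
    rw [this]
    exact zero_mem _
  | succ E ih =>
    choose c v' hv' hvc using fun i => exists_eq_C_mul_add_X_mul (hv i)
    obtain ⟨hc0, hsum⟩ := leading_coeffs_of_sum_eq_X_mul hg₀e hvc (f := 0) (by simpa using hv0)
    have hcs := hadapt (E + 1) (fun j => c j.succ) (by
      rw [hsum, zero_sub]
      exact neg_mem (sum_mem fun i _ => Ideal.mul_mem_left _ _ (Ideal.subset_span ⟨i, rfl⟩)))
    let b : Fin q → MvPolynomial (Fin 2) k := fun j => C (c j.succ) * X 1 ^ (E + 1 - e j)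
    let u : Fin (q + 1) → MvPolynomial (Fin 2) k := fun i => v' i + ∑ j, b j * w j i
    have hb : ∀ j, b j * X 1 ^ e j = C (c j.succ) * X 1 ^ (E + 1) := by
      intro j
      rcases Nat.lt_or_ge (E + 1) (e j) with hlt | hle
      · simp [b, hcs j hlt]
      · rw [mul_assoc, ← pow_add, Nat.sub_add_cancel hle]
    have hu : ∀ i, (u i).IsHomogeneous E := by
      intro i
      refine (hv' i).add (IsHomogeneous.sum _ _ _ fun j _ => ?_)
      rcases Nat.lt_or_ge (E + 1) (e j) with hlt | hle
      · have : b j = 0 := by simp [b, hcs j hlt]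
        rw [this, zero_mul]
        exact isHomogeneous_zero _ _ _
      · have := (isHomogeneous_C_mul_X_pow (c j.succ) (1 : Fin 2) (E + 1 - e j)).mul (hwh j i)
        have hej := he j
        rwa [show E + 1 - e j + (e j - 1) = E by omega] at this
    have hvu : v = ∑ j, b j • consSyz e w j + (X 0 : MvPolynomial (Fin 2) k) • u := by
      ext1 i
      simp only [Pi.add_apply, Finset.sum_apply, Pi.smul_apply, consSyz, Pi.sub_apply,
        smul_eq_mul, mul_sub, Finset.sum_sub_distrib, u, mul_add, Finset.mul_sum, hvc]
      have hcancel : ∑ j, b j * (X 0 * w j i) = ∑ j, X 0 * (b j * w j i) :=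
        Finset.sum_congr rfl fun _ _ => by ring
      have hdiag : ∑ j, b j * (Pi.single j.succ (X 1 ^ e j) : Fin (q + 1) → _) i =
          C (c i) * X 1 ^ (E + 1) := by
        refine Fin.cases ?_ (fun l => ?_) i
        · simp [hc0]
        · rw [Finset.sum_eq_single l]
          · simp [hb]
          · intro j _ hj
            simp [hj.symm]
          · simp
      rw [hcancel, hdiag]
      ring
    have hu0 : ∑ i, u i * consGens g₀ h i = 0 := by
      have hX : (X 0 : MvPolynomial (Fin 2) k) ≠ 0 := X_ne_zero 0
      apply mul_left_cancel₀ hX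
      have hs0 : ∑ i, (∑ j, b j • consSyz e w j) i * consGens g₀ h i = 0 := by
        simp only [Finset.sum_apply, Pi.smul_apply, smul_eq_mul, Finset.sum_mul]
        rw [Finset.sum_comm]
        refine Finset.sum_eq_zero fun j _ => ?_
        simp only [mul_assoc]
        rw [← Finset.mul_sum, sum_consSyz_mul_consGens hw, mul_zero]
      rw [hvu] at hv0
      simp only [Pi.add_apply, add_mul, Finset.sum_add_distrib, hs0, zero_add, Pi.smul_apply,
        smul_eq_mul, mul_assoc] at hv0
      rw [Finset.mul_sum, hv0, mul_zero]
    rw [hvu]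
    exact add_mem (sum_mem fun j _ => Submodule.smul_mem _ _ (Submodule.subset_span ⟨j, rfl⟩))
      (Submodule.smul_mem _ _ (ih hu hu0))

theorem hasMinimalGradedResolution_span_consGens (he : ∀ j, 1 ≤ e j)
    (hg₀ : g₀.IsHomogeneous (D + 1)) (hg₀e : eval ![0, 1] g₀ ≠ 0)
    (hh : ∀ j, (h j).IsHomogeneous D)
    (hmem : ∀ j, X 1 ^ e j * h j ∈ Ideal.span (Set.range (consGens g₀ h)))
    (hadapt : ∀ i, ∀ c : Fin q → k,
      X 1 ^ i * ∑ j, C (c j) * h j ∈ Ideal.span (Set.range (consGens g₀ h)) →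
        ∀ j, i < e j → c j = 0) :
    HasMinimalGradedResolution (Ideal.span (Set.range (consGens g₀ h)))
      (fun _ : Fin (q + 1) => D + 1) (fun j => D + 1 + e j) := by
  have hg := isHomogeneous_consGens hg₀ hh
  have hw : ∀ j, ∃ w : Fin (q + 1) → MvPolynomial (Fin 2) k,
      (∀ i, (w i).IsHomogeneous (e j - 1)) ∧ ∑ i, w i * consGens g₀ h i = X 1 ^ e j * h j := by
    intro j
    refine exists_coeffs_of_mem_span hg (hmem j) ?_
    have := (isHomogeneous_X_pow (R := k) (1 : Fin 2) (e j)).mul (hh j)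
    have hej := he j
    rwa [show e j + D = e j - 1 + (D + 1) by omega] at this
  choose w hwh hw using hw
  have hs := isHomogeneous_consSyz he hwh
  have hs0 : ∀ j i, coeff 0 (consSyz e w j i) = 0 := fun j i =>
    (hs j i).coeff_eq_zero (by have := he j; simp; omega)
  have hsyz : ∀ v : Fin (q + 1) → MvPolynomial (Fin 2) k,
      ∑ i, v i * consGens g₀ h i = 0 ↔
        v ∈ Submodule.span (MvPolynomial (Fin 2) k) (Set.range (consSyz e w)) := by
    intro v
    constructor
    · intro hv
      set M := Finset.univ.sup fun i => (v i).totalDegree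
      have hsum : v = ∑ n ∈ Finset.range (M + 1), fun i => homogeneousComponent n (v i) := by
        ext1 i
        rw [Finset.sum_apply]
        conv_lhs => rw [← sum_homogeneousComponent (v i)]
        refine Finset.sum_subset (Finset.range_mono ?_) fun n _ hn => ?_
        · have : (v i).totalDegree ≤ M :=
            Finset.le_sup (f := fun i => (v i).totalDegree) (Finset.mem_univ i)
          omega
        · refine homogeneousComponent_eq_zero _ _ ?_
          simp only [Finset.mem_range] at hn
          omega
      rw [hsum]
      refine Submodule.sum_mem _ fun n _ => ?_
      refine mem_span_consSyz_of_isHomogeneous he hg₀e hadapt hwh hw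
        (fun i => homogeneousComponent_isHomogeneous n (v i)) ?_
      have := congrArg (homogeneousComponent (n + (D + 1))) hv
      rw [map_sum, map_zero] at this
      rw [← this]
      exact Finset.sum_congr rfl fun i _ => (homogeneousComponent_add_mul (hg i) _ _).symm
    · intro hv
      have hle : Submodule.span (MvPolynomial (Fin 2) k) (Set.range (consSyz e w)) ≤
          LinearMap.ker (Fintype.linearCombination (MvPolynomial (Fin 2) k) (consGens g₀ h)) := by
        rw [Submodule.span_le]
        rintro _ ⟨j, rfl⟩
        exact sum_consSyz_mul_consGens hw j
      exact hle hv
  refine ⟨consGens g₀ h, consSyz e w, hg, rfl, ?_, ?_, hs0, linearIndependent_consSyz, hsyz⟩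
  · intro j hj
    have : ∃ v : Fin (q + 1) → MvPolynomial (Fin 2) k, v j = -1 ∧
        ∑ i, v i * consGens g₀ h i = 0 := by
      obtain ⟨l, hl, hlj⟩ := (Finsupp.mem_span_image_iff_linearCombination _).1 hj
      have hlj0 : l j = 0 := (Finsupp.mem_supported' _ _).1 hl j (by simp)
      rw [Finsupp.linearCombination_apply, Finsupp.sum_fintype _ _ (by simp)] at hlj
      simp only [smul_eq_mul] at hlj
      exact ⟨fun i => l i - (Pi.single j 1 : Fin (q + 1) → MvPolynomial (Fin 2) k) i,
        by simp [hlj0], by simp [sub_mul, Finset.sum_sub_distrib, hlj, Pi.single_apply]⟩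
    obtain ⟨v, hvj, hv⟩ := this
    have hle : Submodule.span (MvPolynomial (Fin 2) k) (Set.range (consSyz e w)) ≤
        Submodule.comap (LinearMap.proj j) (RingHom.ker (constantCoeff (σ := Fin 2) (R := k))) := by
      rw [Submodule.span_le]
      rintro _ ⟨l, rfl⟩
      exact hs0 l j
    have := hle ((hsyz v).1 hv)
    rw [Submodule.mem_comap, LinearMap.proj_apply, hvj, RingHom.mem_ker] at this
    simp at this
  · intro j i
    refine ⟨?_, fun _ => Nat.le_add_right _ _⟩
    rw [Nat.add_sub_cancel_left]
    exact hs j i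

end Resolution

/-- The forms `h` of degree `D` with `x h ∈ L` and `y ^ e h ∈ L`. -/
noncomputable def divisionFiltration (L : Ideal (MvPolynomial (Fin 2) k)) (D e : ℕ) :
    Submodule k (MvPolynomial (Fin 2) k) :=
  homogeneousSubmodule (Fin 2) k D ⊓
    ((L.restrictScalars k).comap (LinearMap.mulLeft k (X 0)) ⊓
      (L.restrictScalars k).comap (LinearMap.mulLeft k (X 1 ^ e)))

lemma mem_divisionFiltration {L : Ideal (MvPolynomial (Fin 2) k)} {D e : ℕ}
    {h : MvPolynomial (Fin 2) k} :
    h ∈ divisionFiltration L D e ↔ h.IsHomogeneous D ∧ X 0 * h ∈ L ∧ X 1 ^ e * h ∈ L :=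
  Iff.rfl

instance finite_divisionFiltration (L : Ideal (MvPolynomial (Fin 2) k)) (D e : ℕ) :
    Module.Finite k (divisionFiltration L D e) :=
  Submodule.finiteDimensional_of_le (inf_le_left : _ ≤ homogeneousSubmodule (Fin 2) k D)

lemma hasRegularity_top : HasRegularity (⊤ : Ideal (MvPolynomial (Fin 2) k)) 0 := by
  refine ⟨1, 0, fun _ => 0, Fin.elim0, ⟨fun _ => 1, Fin.elim0, fun _ => isHomogeneous_one _ _,
    ?_, ?_, fun j => j.elim0, fun j => j.elim0, ?_, ?_⟩, ?_⟩
  · rw [Ideal.eq_top_iff_one]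
    exact Ideal.subset_span ⟨0, rfl⟩
  · intro j
    have : {j' : Fin 1 | j' ≠ j} = ∅ := by
      ext i
      simp [Subsingleton.elim i j]
    simp [this]
  · exact linearIndependent_empty_type
  · intro v
    simp [funext_iff]
  · simp [regOfTwists]

theorem hasRegularity_of_generated {A : Set (MvPolynomial (Fin 2) k)} {D M : ℕ}
    (hA : ∀ a ∈ A, a.IsHomogeneous (D + 1))
    (hM : ∀ f : MvPolynomial (Fin 2) k, f.IsHomogeneous (D + 1 + M) → f ∈ Ideal.span A)
    (hM' : M = 0 ∨ ∃ f : MvPolynomial (Fin 2) k, f.IsHomogeneous (D + M) ∧ f ∉ Ideal.span A) :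
    HasRegularity (Ideal.span A) ((D + 1 + M : ℕ) : ℤ) := by
  set L := Ideal.span A with hL
  have hmono : Monotone (divisionFiltration L D) := by
    intro i j hij h hh
    rw [mem_divisionFiltration] at hh ⊢
    refine ⟨hh.1, hh.2.1, ?_⟩
    rw [← Nat.sub_add_cancel hij, pow_add, mul_assoc]
    exact L.mul_mem_left _ hh.2.2
  have hzero : divisionFiltration L D 0 = ⊥ := by
    rw [eq_bot_iff]
    intro h hh
    rw [mem_divisionFiltration, pow_zero, one_mul] at hh
    exact eq_zero_of_mem_span_of_lt hA hh.2.2 hh.1 (Nat.lt_succ_self D)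
  have htop : ∀ h : MvPolynomial (Fin 2) k, h.IsHomogeneous D → X 0 * h ∈ L →
      h ∈ divisionFiltration L D (M + 1) := by
    intro h hh hx
    refine ⟨hh, hx, hM _ ?_⟩
    have := (isHomogeneous_X_pow (R := k) (1 : Fin 2) (M + 1)).mul hh
    rwa [show M + 1 + D = D + 1 + M by omega] at this
  obtain ⟨q, h, e, hspan, he, hadapt⟩ :=
    exists_adapted_family (divisionFiltration L D) hmono hzero (fun _ => inferInstance) (M + 1)
  have hhom : ∀ j, (h j).IsHomogeneous D := fun j => (he j).2.2.1
  obtain ⟨g₀, hg₀A, hg₀e⟩ : ∃ g₀ ∈ A, eval ![(0 : k), 1] g₀ ≠ 0 := by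
    by_contra! hcon
    have hle : L ≤ RingHom.ker (eval ![(0 : k), 1]) := Ideal.span_le.2 hcon
    have := hle (hM _ (isHomogeneous_X_pow 1 _))
    simp [RingHom.mem_ker] at this
  have hg₀ := hA g₀ hg₀A
  have hgL : L = Ideal.span (Set.range (consGens g₀ h)) := by
    apply le_antisymm
    · rw [hL, Ideal.span_le]
      intro f hf
      obtain ⟨c, f', hf', hfc⟩ := exists_eq_C_mul_add_X_mul (hA f hf)
      obtain ⟨c₀, g', hg', hgc⟩ := exists_eq_C_mul_add_X_mul hg₀
      have hc₀ : c₀ ≠ 0 := by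
        rw [hgc] at hg₀e
        simpa using hg₀e
      have hC : (C c : MvPolynomial (Fin 2) k) = C (c / c₀) * C c₀ := by
        rw [← C_mul, div_mul_cancel₀ _ hc₀]
      have hdiff : f = C (c / c₀) * g₀ + X 0 * (f' - C (c / c₀) * g') := by
        rw [hfc, hgc, hC]
        ring
      have hmem : f' - C (c / c₀) * g' ∈ divisionFiltration L D (M + 1) := by
        refine htop _ (hf'.sub (hg'.C_mul _)) ?_
        rw [eq_sub_of_add_eq' hdiff.symm]
        exact sub_mem (Ideal.subset_span hf) (L.mul_mem_left _ (Ideal.subset_span hg₀A))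
      rw [← hspan, Submodule.mem_span_range_iff_exists_fun] at hmem
      obtain ⟨b, hb⟩ := hmem
      rw [SetLike.mem_coe, hdiff, ← hb, Finset.mul_sum]
      refine add_mem (Ideal.mul_mem_left _ _ (Ideal.subset_span ⟨0, rfl⟩))
        (sum_mem fun j _ => ?_)
      rw [smul_eq_C_mul, mul_left_comm]
      exact Ideal.mul_mem_left _ _ (Ideal.subset_span ⟨j.succ, rfl⟩)
    · rw [Ideal.span_le]
      rintro _ ⟨i, rfl⟩
      exact Fin.cases (Ideal.subset_span hg₀A) (fun j => (he j).2.2.2.1) i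
  have hres : HasMinimalGradedResolution L (fun _ : Fin (q + 1) => D + 1)
      (fun j => D + 1 + e j) := by
    rw [hgL]
    refine hasMinimalGradedResolution_span_consGens (fun j => (he j).1) hg₀ hg₀e hhom ?_ ?_
    · intro j
      rw [← hgL]
      exact (he j).2.2.2.2
    · intro i c hc j hij
      rw [← hgL] at hc
      refine hadapt i ?_ c ⟨?_, ?_, ?_⟩ j hij
      · have := (he j).2.1
        omega
      · exact Submodule.sum_mem _ fun j _ => Submodule.smul_mem _ _ (hhom j)
      · have : X 0 * ∑ j, c j • h j ∈ L := by
          rw [Finset.mul_sum]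
          refine sum_mem fun j _ => ?_
          rw [smul_eq_C_mul, mul_left_comm]
          exact L.mul_mem_left _ (he j).2.2.2.1
        exact this
      · have : X 1 ^ i * ∑ j, c j • h j ∈ L := by
          simpa only [smul_eq_C_mul] using hc
        exact this
  refine ⟨q + 1, q, _, _, hres, ?_⟩
  have hsup₀ : (Finset.univ.sup fun _ : Fin (q + 1) => D + 1) = D + 1 :=
    Finset.sup_const Finset.univ_nonempty _
  have hsup_le : (Finset.univ.sup fun j => D + 1 + e j) ≤ D + 1 + (M + 1) :=
    Finset.sup_le fun j _ => by
      have := (he j).2.1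
      omega
  have hsup_ge : M = 0 ∨ D + 1 + (M + 1) ≤ Finset.univ.sup fun j => D + 1 + e j := by
    rcases M with - | M
    · exact Or.inl rfl
    right
    obtain ⟨f, hf, hfL⟩ := hM'.resolve_left (Nat.succ_ne_zero M)
    have hex : ∃ j, e j = M + 1 + 1 := by
      by_contra! hne
      have hle : divisionFiltration L D (M + 1 + 1) ≤ divisionFiltration L D (M + 1) := by
        rw [← hspan, Submodule.span_le]
        rintro _ ⟨j, rfl⟩
        have h₁ := (he j).2.1
        have h₂ := hne j
        exact hmono (by omega) (he j).2.2
      have hxf : X 0 * f ∈ L := hM _ (by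
        have := (isHomogeneous_X k (0 : Fin 2)).mul hf
        rwa [show 1 + (D + (M + 1)) = D + 1 + (M + 1) by omega] at this)
      obtain ⟨w, hw, hwf⟩ := exists_coeffs_of_mem_span (j := M + 1)
        (isHomogeneous_consGens hg₀ hhom) (hgL ▸ hxf) (by
          have := (isHomogeneous_X k (0 : Fin 2)).mul hf
          rwa [show 1 + (D + (M + 1)) = M + 1 + (D + 1) by omega] at this)
      choose c w' _ hwc using fun i => exists_eq_C_mul_add_X_mul (hw i)
      obtain ⟨-, hsum⟩ := leading_coeffs_of_sum_eq_X_mul hg₀e hwc hwf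
      apply hfL
      rw [← sub_add_cancel f (∑ i, w' i * consGens g₀ h i), ← hsum]
      refine add_mem ?_ (sum_mem fun i _ => L.mul_mem_left _ (hgL ▸ Ideal.subset_span ⟨i, rfl⟩))
      have hmem : ∑ j, C (c (Fin.succ j)) * h j ∈ divisionFiltration L D (M + 1) := by
        simp only [← smul_eq_C_mul]
        exact sum_mem fun j _ => Submodule.smul_mem _ _
          (hle (hspan ▸ Submodule.subset_span ⟨j, rfl⟩))
      exact hmem.2.2
    obtain ⟨j, hj⟩ := hex
    rw [← hj]
    exact Finset.le_sup (f := fun j => D + 1 + e j) (Finset.mem_univ j)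
  rw [regOfTwists, hsup₀]
  omega

section Forms

variable {F₁ F₂ : MvPolynomial (Fin 2) k} {a b : ℕ}

/-- The map `(u, v) ↦ u F₁ + v F₂` on forms of fixed degrees. -/
noncomputable def formsMap (hF₁ : F₁.IsHomogeneous a) (hF₂ : F₂.IsHomogeneous b) {p q e : ℕ}
    (hp : p + a = e) (hq : q + b = e) :
    (homogeneousSubmodule (Fin 2) k p × homogeneousSubmodule (Fin 2) k q) →ₗ[k]
      homogeneousSubmodule (Fin 2) k e :=
  LinearMap.codRestrict _
    (((LinearMap.mulRight k F₁).comp (Submodule.subtype _)).coprod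
      ((LinearMap.mulRight k F₂).comp (Submodule.subtype _)))
    fun x => Submodule.add_mem _ (hp ▸ IsHomogeneous.mul x.1.2 hF₁)
      (hq ▸ IsHomogeneous.mul x.2.2 hF₂)

lemma coe_formsMap (hF₁ : F₁.IsHomogeneous a) (hF₂ : F₂.IsHomogeneous b) {p q e : ℕ}
    (hp : p + a = e) (hq : q + b = e)
    (x : homogeneousSubmodule (Fin 2) k p × homogeneousSubmodule (Fin 2) k q) :
    (formsMap hF₁ hF₂ hp hq x : MvPolynomial (Fin 2) k) = x.1 * F₁ + x.2 * F₂ :=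
  rfl

lemma eq_zero_of_dvd_of_lt {f g : MvPolynomial (Fin 2) k} {p : ℕ} (hg : g.IsHomogeneous b)
    (hf : f.IsHomogeneous p) (hpb : p < b) (hdvd : g ∣ f) : f = 0 := by
  obtain ⟨t, rfl⟩ := hdvd
  rw [mul_comm] at hf ⊢
  rw [← homogeneousComponent_eq_self hf]
  exact homogeneousComponent_mul_of_lt hg t hpb

lemma degree_eq_zero_of_isUnit (hF₁ : F₁.IsHomogeneous a) (hu : IsUnit F₁) : a = 0 := by
  by_contra ha
  exact one_ne_zero (eq_zero_of_dvd_of_lt hF₁ (isHomogeneous_one _ _) (Nat.pos_of_ne_zero ha)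
    hu.dvd)

lemma ne_zero_of_isRelPrime (hF₁ : F₁.IsHomogeneous a) (hrel : IsRelPrime F₁ F₂) (ha : a ≠ 0) :
    F₂ ≠ 0 := by
  rintro rfl
  exact ha (degree_eq_zero_of_isUnit hF₁ (isRelPrime_zero_right.1 hrel))

lemma exists_mul_add_mul_eq_aux (hF₁ : F₁.IsHomogeneous a) (hF₂ : F₂.IsHomogeneous b)
    (hrel : IsRelPrime F₁ F₂) (ha : 1 ≤ a) (hb : 1 ≤ b) {f : MvPolynomial (Fin 2) k}
    (hf : f.IsHomogeneous (a + b - 1)) :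
    ∃ u v : MvPolynomial (Fin 2) k, u.IsHomogeneous (b - 1) ∧ v.IsHomogeneous (a - 1) ∧
      f = u * F₁ + v * F₂ := by
  have hF₂0 := ne_zero_of_isRelPrime hF₁ hrel (by omega)
  have hp : b - 1 + a = a + b - 1 := by omega
  have hq : a - 1 + b = a + b - 1 := by omega
  have hinj : Function.Injective (formsMap hF₁ hF₂ hp hq) := by
    rw [← LinearMap.ker_eq_bot, LinearMap.ker_eq_bot']
    rintro ⟨⟨u, hu⟩, ⟨v, hv⟩⟩ huv
    have huv := congrArg Subtype.val huv
    rw [coe_formsMap] at huv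
    simp only [ZeroMemClass.coe_zero] at huv
    have hu0 : u = 0 := by
      refine eq_zero_of_dvd_of_lt hF₂ hu (by omega) (hrel.symm.dvd_of_dvd_mul_right ?_)
      exact ⟨-v, by linear_combination huv⟩
    have hv0 : v = 0 := by
      rw [hu0, zero_mul, zero_add] at huv
      exact (mul_eq_zero.1 huv).resolve_right hF₂0
    subst hu0 hv0
    rfl
  have hrank : Module.finrank k
        (homogeneousSubmodule (Fin 2) k (b - 1) × homogeneousSubmodule (Fin 2) k (a - 1)) =
      Module.finrank k (homogeneousSubmodule (Fin 2) k (a + b - 1)) := by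
    rw [Module.finrank_prod]
    simp only [finrank_homogeneousSubmodule]
    omega
  obtain ⟨x, hx⟩ :=
    (LinearMap.injective_iff_surjective_of_finrank_eq_finrank hrank).1 hinj ⟨f, hf⟩
  exact ⟨x.1, x.2, x.1.2, x.2.2, by rw [← coe_formsMap hF₁ hF₂ hp hq, hx]⟩

lemma exists_mul_add_mul_eq (hF₁ : F₁.IsHomogeneous a) (hF₂ : F₂.IsHomogeneous b)
    (hrel : IsRelPrime F₁ F₂) (hba : b ≤ a) {e : ℕ} (hae : a ≤ e) (hab : a + b ≤ e + 1)
    {f : MvPolynomial (Fin 2) k} (hf : f.IsHomogeneous e) :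
    ∃ u v : MvPolynomial (Fin 2) k, u.IsHomogeneous (e - a) ∧ v.IsHomogeneous (e - b) ∧
      f = u * F₁ + v * F₂ := by
  rcases Nat.eq_zero_or_pos b with rfl | hb
  · obtain ⟨c, rfl⟩ := exists_eq_C hF₂
    rcases eq_or_ne c 0 with rfl | hc
    · rw [map_zero, isRelPrime_zero_right] at hrel
      obtain rfl := degree_eq_zero_of_isUnit hF₁ hrel
      obtain ⟨c', rfl⟩ := exists_eq_C hF₁
      have hc' : c' ≠ 0 := by
        rintro rfl
        simp at hrel
      refine ⟨C c'⁻¹ * f, 0, hf.C_mul _, isHomogeneous_zero _ _ _, ?_⟩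
      rw [mul_right_comm, ← C_mul, inv_mul_cancel₀ hc']
      simp
    · refine ⟨0, C c⁻¹ * f, isHomogeneous_zero _ _ _, hf.C_mul _, ?_⟩
      rw [mul_right_comm, ← C_mul, inv_mul_cancel₀ hc]
      simp
  · have hle : a + b - 1 ≤ e := by omega
    clear hae hab
    induction e, hle using Nat.le_induction generalizing f with
    | base =>
      rw [show a + b - 1 - a = b - 1 by omega, show a + b - 1 - b = a - 1 by omega]
      exact exists_mul_add_mul_eq_aux hF₁ hF₂ hrel (by omega) hb hf
    | succ e he ih =>
      obtain ⟨c, f', hf', rfl⟩ := exists_eq_C_mul_add_X_mul hf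
      obtain ⟨u₁, v₁, hu₁, hv₁, h₁⟩ := ih (isHomogeneous_C_mul_X_pow c 1 e)
      obtain ⟨u₂, v₂, hu₂, hv₂, h₂⟩ := ih hf'
      refine ⟨X 1 * u₁ + X 0 * u₂, X 1 * v₁ + X 0 * v₂, ?_, ?_, ?_⟩
      · rw [show e + 1 - a = 1 + (e - a) by omega]
        exact ((isHomogeneous_X _ _).mul hu₁).add ((isHomogeneous_X _ _).mul hu₂)
      · rw [show e + 1 - b = 1 + (e - b) by omega]
        exact ((isHomogeneous_X _ _).mul hv₁).add ((isHomogeneous_X _ _).mul hv₂)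
      · linear_combination X 1 * h₁ + X 0 * h₂

lemma exists_notMem_span_pair (hF₁ : F₁.IsHomogeneous a) (hF₂ : F₂.IsHomogeneous b)
    (ha : 2 ≤ a) (hb : 2 ≤ b) :
    ∃ f : MvPolynomial (Fin 2) k, f.IsHomogeneous (a + b - 2) ∧
      f ∉ Ideal.span {F₁} ⊔ Ideal.span {F₂} := by
  by_contra! hcon
  have hp : b - 2 + a = a + b - 2 := by omega
  have hq : a - 2 + b = a + b - 2 := by omega
  have hsurj : Function.Surjective (formsMap hF₁ hF₂ hp hq) := by
    rintro ⟨f, hf⟩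
    obtain ⟨_, hx, _, hy, hxy⟩ := Submodule.mem_sup.1 (hcon f hf)
    obtain ⟨u, rfl⟩ := Ideal.mem_span_singleton'.1 hx
    obtain ⟨v, rfl⟩ := Ideal.mem_span_singleton'.1 hy
    refine ⟨(⟨_, homogeneousComponent_mem (b - 2) u⟩, ⟨_, homogeneousComponent_mem (a - 2) v⟩),
      Subtype.ext ?_⟩
    rw [coe_formsMap, ← homogeneousComponent_add_mul hF₁, ← homogeneousComponent_add_mul hF₂, hp,
      hq, ← map_add, hxy, homogeneousComponent_eq_self hf]
  have := LinearMap.finrank_le_finrank_of_surjective hsurj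
  rw [Module.finrank_prod] at this
  simp only [finrank_homogeneousSubmodule] at this
  omega

lemma sup_pow_succ_le {S : Type*} [CommSemiring S] (A B : Ideal S) (s : ℕ) :
    (A ⊔ B) ^ (s + 1) ≤ A * (A ⊔ B) ^ s ⊔ B ^ (s + 1) := by
  induction s with
  | zero => simp
  | succ s ih =>
    rw [pow_succ', Ideal.sup_mul]
    refine sup_le le_sup_left ((Ideal.mul_mono_right ih).trans ?_)
    rw [Ideal.mul_sup, ← pow_succ', mul_left_comm]
    refine sup_le_sup_right (Ideal.mul_mono_right ?_) _
    rw [pow_succ']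
    exact Ideal.mul_mono_left le_sup_right

lemma mem_pow_of_mul_mem_pow_succ (hrel : IsRelPrime F₁ F₂) (hF₁ : F₁ ≠ 0) {s : ℕ}
    {f : MvPolynomial (Fin 2) k}
    (hf : F₁ * f ∈ (Ideal.span {F₁} ⊔ Ideal.span {F₂}) ^ (s + 1)) :
    f ∈ (Ideal.span {F₁} ⊔ Ideal.span {F₂}) ^ s := by
  obtain ⟨_, hx, _, hy, hxy⟩ := Submodule.mem_sup.1 (sup_pow_succ_le _ _ s hf)
  obtain ⟨z, hz, rfl⟩ := Ideal.mem_span_singleton_mul.1 hx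
  rw [Ideal.span_singleton_pow] at hy
  obtain ⟨t, rfl⟩ := Ideal.mem_span_singleton'.1 hy
  obtain ⟨t', rfl⟩ : F₁ ∣ t :=
    (hrel.pow_right : IsRelPrime F₁ (F₂ ^ (s + 1))).dvd_of_dvd_mul_right
      ⟨f - z, by linear_combination hxy⟩
  have : f = z + t' * F₂ * F₂ ^ s := by
    apply mul_left_cancel₀ hF₁
    linear_combination -hxy
  rw [this]
  exact add_mem hz (Ideal.mul_mem_left _ _
    (Ideal.pow_mem_pow (Ideal.mem_sup_right (Ideal.mem_span_singleton_self _)) _))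

lemma exists_notMem_span_pair_pow (hF₁ : F₁.IsHomogeneous a) (hF₂ : F₂.IsHomogeneous b)
    (hrel : IsRelPrime F₁ F₂) (ha : 2 ≤ a) (hb : 2 ≤ b) {s : ℕ} (hs : 1 ≤ s) :
    ∃ f : MvPolynomial (Fin 2) k, f.IsHomogeneous (s * a + b - 2) ∧
      f ∉ (Ideal.span {F₁} ⊔ Ideal.span {F₂}) ^ s := by
  induction s, hs using Nat.le_induction with
  | base => simpa using exists_notMem_span_pair hF₁ hF₂ ha hb
  | succ s _ ih =>
    obtain ⟨f, hf, hfs⟩ := ih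
    refine ⟨F₁ * f, ?_, fun hmem => hfs (mem_pow_of_mul_mem_pow_succ hrel ?_ hmem)⟩
    · have := hF₁.mul hf
      rwa [show a + (s * a + b - 2) = (s + 1) * a + b - 2 by
        rw [add_mul, one_mul]; omega] at this
    · exact ne_zero_of_isRelPrime hF₂ hrel.symm (by omega)

end Forms

/-- The ideal is generated by forms of degree `D`. -/
def GeneratedInDegree (I : Ideal (MvPolynomial (Fin 2) k)) (D : ℕ) : Prop :=
  ∃ A : Set (MvPolynomial (Fin 2) k), (∀ f ∈ A, f.IsHomogeneous D) ∧ I = Ideal.span A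

namespace GeneratedInDegree

variable {I J : Ideal (MvPolynomial (Fin 2) k)} {D E : ℕ}

lemma sup (hI : GeneratedInDegree I D) (hJ : GeneratedInDegree J D) :
    GeneratedInDegree (I ⊔ J) D := by
  obtain ⟨A, hA, rfl⟩ := hI
  obtain ⟨B, hB, rfl⟩ := hJ
  exact ⟨A ∪ B, fun f hf => hf.elim (hA f) (hB f), (Ideal.span_union A B).symm⟩

lemma mul (hI : GeneratedInDegree I D) (hJ : GeneratedInDegree J E) :
    GeneratedInDegree (I * J) (D + E) := by
  obtain ⟨A, hA, rfl⟩ := hI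
  obtain ⟨B, hB, rfl⟩ := hJ
  refine ⟨{f | ∃ g ∈ A, ∃ h ∈ B, g * h = f}, ?_, ?_⟩
  · rintro _ ⟨g, hg, h, hh, rfl⟩
    exact (hA g hg).mul (hB h hh)
  · rw [Ideal.span_mul_span']
    rfl

lemma pow (hI : GeneratedInDegree I D) (s : ℕ) : GeneratedInDegree (I ^ s) (s * D) := by
  induction s with
  | zero =>
    refine ⟨{1}, ?_, by simp⟩
    rintro _ rfl
    simpa using isHomogeneous_one (Fin 2) k
  | succ s ih =>
    rw [pow_succ, add_mul, one_mul]
    exact ih.mul hI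

lemma span_singleton {f : MvPolynomial (Fin 2) k} (hf : f.IsHomogeneous D) :
    GeneratedInDegree (Ideal.span {f}) D :=
  ⟨{f}, by rintro _ rfl; exact hf, rfl⟩

lemma span_X : GeneratedInDegree (Ideal.span {X 0, X 1} : Ideal (MvPolynomial (Fin 2) k)) 1 :=
  ⟨{X 0, X 1}, by rintro _ (rfl | rfl) <;> exact isHomogeneous_X _ _, rfl⟩

lemma mem_pow_mul {j e : ℕ} (hI : GeneratedInDegree I D) {f : MvPolynomial (Fin 2) k}
    (hf : f ∈ I) (hfe : f.IsHomogeneous e) (hje : j + D ≤ e) :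
    f ∈ (Ideal.span {X 0, X 1}) ^ j * I := by
  obtain ⟨A, hA, rfl⟩ := hI
  refine Ideal.mul_mono_left (Ideal.pow_le_pow_right (by omega : j ≤ e - D))
    (mem_pow_mul_of_mem_span hA hf ?_)
  rwa [Nat.sub_add_cancel (by omega)]

theorem hasRegularity {M : ℕ} (hI : GeneratedInDegree I (D + 1))
    (hM : ∀ f : MvPolynomial (Fin 2) k, f.IsHomogeneous (D + 1 + M) → f ∈ I)
    (hM' : M = 0 ∨ ∃ f : MvPolynomial (Fin 2) k, f.IsHomogeneous (D + M) ∧ f ∉ I) :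
    HasRegularity I ((D + 1 + M : ℕ) : ℤ) := by
  obtain ⟨A, hA, rfl⟩ := hI
  exact hasRegularity_of_generated hA hM hM'

end GeneratedInDegree

section Truncation

variable {F₁ F₂ : MvPolynomial (Fin 2) k} {n σ τ : ℕ}

lemma generatedInDegree_truncation (hF₁ : F₁.IsHomogeneous (n + σ))
    (hF₂ : F₂.IsHomogeneous (n + τ)) :
    GeneratedInDegree ((Ideal.span {X 0, X 1}) ^ τ * Ideal.span {F₁}
      + (Ideal.span {X 0, X 1}) ^ σ * Ideal.span {F₂}) (n + σ + τ) := by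
  have h₁ := (GeneratedInDegree.span_X.pow τ).mul (.span_singleton hF₁)
  have h₂ := (GeneratedInDegree.span_X.pow σ).mul (.span_singleton hF₂)
  rw [show τ * 1 + (n + σ) = n + σ + τ by omega] at h₁
  rw [show σ * 1 + (n + τ) = n + σ + τ by omega] at h₂
  exact h₁.sup h₂

lemma mem_truncation_pow (hστ : τ ≤ σ) (hF₁ : F₁.IsHomogeneous (n + σ))
    (hF₂ : F₂.IsHomogeneous (n + τ)) (hrel : IsRelPrime F₁ F₂) {s e : ℕ}
    (hse : s * (n + σ + τ) ≤ e) (hse' : s * (n + σ) + (n + τ) ≤ e + 1)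
    {f : MvPolynomial (Fin 2) k} (hf : f.IsHomogeneous e) :
    f ∈ ((Ideal.span {X 0, X 1}) ^ τ * Ideal.span {F₁}
      + (Ideal.span {X 0, X 1}) ^ σ * Ideal.span {F₂}) ^ s := by
  induction s generalizing e f with
  | zero => simp
  | succ s ih =>
    have hgen := (generatedInDegree_truncation hF₁ hF₂).pow s
    rw [add_mul, one_mul] at hse hse'
    obtain ⟨u, v, hu, hv, rfl⟩ := exists_mul_add_mul_eq hF₁ hF₂ hrel (by omega : n + τ ≤ n + σ)
      (by omega : n + σ ≤ e) (by omega) hf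
    have hu' := hgen.mem_pow_mul (j := τ) (ih (by omega) (by omega) hu) hu (by omega)
    have hv' := hgen.mem_pow_mul (j := σ) (ih (by omega) (by omega) hv) hv (by omega)
    rw [pow_succ', add_mul]
    refine add_mem (Ideal.mem_sup_left ?_) (Ideal.mem_sup_right ?_)
    · rw [mul_right_comm]
      exact Ideal.mul_mem_mul hu' (Ideal.mem_span_singleton_self _)
    · rw [mul_right_comm]
      exact Ideal.mul_mem_mul hv' (Ideal.mem_span_singleton_self _)

lemma exists_notMem_truncation_pow (hF₁ : F₁.IsHomogeneous (n + σ))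
    (hF₂ : F₂.IsHomogeneous (n + τ)) (hrel : IsRelPrime F₁ F₂) (hn : 2 ≤ n) {s : ℕ}
    (hs : 1 ≤ s) :
    ∃ f : MvPolynomial (Fin 2) k, f.IsHomogeneous (s * (n + σ) + (n + τ) - 2) ∧
      f ∉ ((Ideal.span {X 0, X 1}) ^ τ * Ideal.span {F₁}
        + (Ideal.span {X 0, X 1}) ^ σ * Ideal.span {F₂}) ^ s := by
  obtain ⟨f, hf, hfs⟩ := exists_notMem_span_pair_pow hF₁ hF₂ hrel (by omega) (by omega) hs
  refine ⟨f, hf, fun hmem => hfs (Ideal.pow_right_mono ?_ s hmem)⟩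
  exact sup_le_sup Ideal.mul_le_right Ideal.mul_le_right

end Truncation

end TruncationPowers

/-!
STATEMENT 6 (Corollary C2.6).  Let `σ ≥ τ ≥ 0`, let `F₁, F₂` be relatively prime forms
in `R = k[x,y]` of degrees `n+σ` and `n+τ`, let `I = (x,y)^τ F₁ + (x,y)^σ F₂` and
`d = n+σ+τ`.  Then for every `s ≥ 1`,
`reg I^s = max { sd, sd − (s−1)τ + n − 1 }`.
-/

theorem regularity_of_powers_of_truncation
    {k : Type*} [Field k] (n σ τ : ℕ) (hστ : τ ≤ σ)
    (F₁ F₂ : MvPolynomial (Fin 2) k)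
    (hF₁ : F₁.IsHomogeneous (n + σ)) (hF₂ : F₂.IsHomogeneous (n + τ))
    (hrel : IsRelPrime F₁ F₂)
    (I : Ideal (MvPolynomial (Fin 2) k))
    (hI : I = (Ideal.span {X 0, X 1}) ^ τ * Ideal.span {F₁}
            + (Ideal.span {X 0, X 1}) ^ σ * Ideal.span {F₂})
    (d : ℕ) (hd : d = n + σ + τ)
    (s : ℕ) (hs : 1 ≤ s) :
    HasRegularity (I ^ s)
      (max ((s : ℤ) * d) ((s : ℤ) * d - ((s : ℤ) - 1) * τ + (n : ℤ) - 1)) := by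
  subst hI hd
  have hgen := (TruncationPowers.generatedInDegree_truncation hF₁ hF₂).pow s
  have hcast : (s : ℤ) * ((n + σ + τ : ℕ) : ℤ) - ((s : ℤ) - 1) * τ + n - 1 =
      ((s * (n + σ) + (n + τ) : ℕ) : ℤ) - 1 := by
    push_cast
    ring
  rw [hcast, ← Nat.cast_mul]
  rcases Nat.eq_zero_or_eq_succ_pred (s * (n + σ + τ)) with h0 | hpos
  · have hd0 : n + σ + τ = 0 := (Nat.mul_eq_zero.1 h0).resolve_left (by omega)
    obtain ⟨rfl, rfl, rfl⟩ : n = 0 ∧ σ = 0 ∧ τ = 0 := by omega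
    have htop := (Ideal.eq_top_iff_one _).2 (TruncationPowers.mem_truncation_pow (s := s) (e := 0)
      hστ hF₁ hF₂ hrel (by simp) (by simp) (isHomogeneous_one _ _))
    rw [htop]
    simpa using TruncationPowers.hasRegularity_top
  · set D := (s * (n + σ + τ)).pred
    rw [hpos] at hgen
    have hreg := hgen.hasRegularity (M := s * (n + σ) + (n + τ) - 1 - s * (n + σ + τ))
      (fun f hf => TruncationPowers.mem_truncation_pow hστ hF₁ hF₂ hrel (by omega) (by omega) hf)
      (by
        refine (Nat.eq_zero_or_pos _).imp_right fun hM => ?_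
        have hsτ : τ ≤ s * τ := Nat.le_mul_of_pos_left τ hs
        have hexp : s * (n + σ + τ) = s * (n + σ) + s * τ := by ring
        obtain ⟨f, hf, hfI⟩ :=
          TruncationPowers.exists_notMem_truncation_pow hF₁ hF₂ hrel (by omega) hs
        refine ⟨f, ?_, hfI⟩
        convert hf using 1
        omega)
    convert hreg using 1
    omega
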